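/- A (K,H)-linear Weingarten canal surface whose center curve never straightens is a tube of a specific radius: let a, b, d ∈ ℝ with (a,b,d) ≠ (0,0,0), suppose κ(s) ≠ 0 for all s, (EG − F²)(s,t) ≠ 0 for all (s,t), and a·K(s,t) + b·H(s,t) = d for all (s,t). Then d ≠ 0, b² + 4ad = 0, and r is constant with r(s) = −b/(2d) for all s. -/

import Mathlib

open scoped RealInnerProductSpace

/-- The inner product of two vectors in terms of their coordinates in an orthonormal frame. -/
theorem inner_orthonormal_frame {V : Type*} [NormedAddCommGroup V] [InnerProductSpace ℝ V]
    {T N B : V} (hT : ‖T‖ = 1) (hN : ‖N‖ = 1) (hB : ‖B‖ = 1)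
    (hTN : ⟪T, N⟫ = 0) (hTB : ⟪T, B⟫ = 0) (hNB : ⟪N, B⟫ = 0) (x y z x' y' z' : ℝ) :
    ⟪x • T + y • N + z • B, x' • T + y' • N + z' • B⟫ = x * x' + y * y' + z * z' := by
  have hNT : ⟪N, T⟫ = 0 := by rw [real_inner_comm, hTN]
  have hBT : ⟪B, T⟫ = 0 := by rw [real_inner_comm, hTB]
  have hBN : ⟪B, N⟫ = 0 := by rw [real_inner_comm, hNB]
  simp only [inner_add_left, inner_add_right, real_inner_smul_left, real_inner_smul_right,
    real_inner_self_eq_norm_sq, hT, hN, hB, hTN, hTB, hNB, hNT, hBT, hBN]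
  ring

/-- If `⟪u, v⟫` vanishes identically, differentiation moves from `u` to `v` at the cost of a
sign. -/
theorem inner_deriv_eq_neg_of_inner_eq_zero {V : Type*} [NormedAddCommGroup V]
    [InnerProductSpace ℝ V] {u v : ℝ → V} {v' : V} {s : ℝ} (hu : DifferentiableAt ℝ u s)
    (hv : HasDerivAt v v' s) (huv : ∀ x, ⟪u x, v x⟫ = 0) :
    ⟪deriv u s, v s⟫ = -⟪u s, v'⟫ := by
  have h := hu.hasDerivAt.inner ℝ hv
  simp only [huv] at h
  linarith [h.unique (hasDerivAt_const s (0 : ℝ))]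

/-- The pointwise linear Weingarten relation of a canal surface, whose fundamental forms satisfy
`e = -(E - m) / ρ`, `f = -F / ρ`, `g = -G / ρ`, with denominators cleared. -/
theorem canal_weingarten_relation {E F G m q ρ a b d : ℝ} (hρ : ρ ≠ 0) (hG : G = q ^ 2)
    (hdet : E * G - F ^ 2 = ρ ^ 2 * m ^ 2) (hm : m ≠ 0)
    (h : a * ((-(E - m) / ρ * (-G / ρ) - (-F / ρ) ^ 2) / (E * G - F ^ 2)) +
      b * ((E * (-G / ρ) - 2 * F * (-F / ρ) + G * (-(E - m) / ρ)) / (2 * (E * G - F ^ 2))) = d) :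
    m * (ρ ^ 2 * (a - b * ρ - d * ρ ^ 2)) = q ^ 2 * (a - b * ρ / 2) := by
  have h1 : -(E - m) / ρ * (-G / ρ) - (-F / ρ) ^ 2 = (ρ ^ 2 * m ^ 2 - m * q ^ 2) / ρ ^ 2 := by
    rw [← hdet, ← hG]; field_simp; ring
  have h2 : E * (-G / ρ) - 2 * F * (-F / ρ) + G * (-(E - m) / ρ) =
      (m * q ^ 2 - 2 * (ρ ^ 2 * m ^ 2)) / ρ := by
    rw [← hdet, ← hG]; field_simp; ring
  rw [h1, h2, hdet] at h
  field_simp at h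
  linarith

/-- An affine relation satisfied at two distinct points determines the coefficients. -/
theorem eq_zero_of_mul_eq_of_ne {x y p c : ℝ} (hxy : x ≠ y) (hx : x * p = c) (hy : y * p = c) :
    p = 0 ∧ c = 0 := by
  have hp : p = 0 := by
    have h : (x - y) * p = 0 := by linarith
    exact (mul_eq_zero.mp h).resolve_left (sub_ne_zero.mpr hxy)
  exact ⟨hp, by rw [← hx, hp, mul_zero]⟩

theorem KH_linear_Weingarten_is_tube
    (α T N B : ℝ → EuclideanSpace ℝ (Fin 3)) (κ τ r : ℝ → ℝ)
    (hα : ContDiff ℝ (⊤ : ℕ∞) α) (hT : ContDiff ℝ (⊤ : ℕ∞) T)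
    (hN : ContDiff ℝ (⊤ : ℕ∞) N) (hB : ContDiff ℝ (⊤ : ℕ∞) B)
    (hκ : ContDiff ℝ (⊤ : ℕ∞) κ) (hτ : ContDiff ℝ (⊤ : ℕ∞) τ)
    (hr : ContDiff ℝ (⊤ : ℕ∞) r)
    (hTα : ∀ s, T s = deriv α s)
    (hT1 : ∀ s, ‖T s‖ = 1) (hN1 : ∀ s, ‖N s‖ = 1) (hB1 : ∀ s, ‖B s‖ = 1)
    (hTN : ∀ s, ⟪T s, N s⟫ = 0) (hTB : ∀ s, ⟪T s, B s⟫ = 0)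
    (hNB : ∀ s, ⟪N s, B s⟫ = 0)
    (hT' : ∀ s, deriv T s = κ s • N s)
    (hN' : ∀ s, deriv N s = (-κ s) • T s + τ s • B s)
    (hB' : ∀ s, deriv B s = (-τ s) • N s)
    (hrpos : ∀ s, 0 < r s) (hr1 : ∀ s, |deriv r s| < 1)
    (R Q : ℝ → ℝ)
    (hR : ∀ s, R s = r s * deriv r s)
    (hQ : ∀ s, Q s = r s * Real.sqrt (1 - (deriv r s) ^ 2))
    (C : ℝ → ℝ → EuclideanSpace ℝ (Fin 3))
    (hC : ∀ s t, C s t = α s - R s • T s - (Q s * Real.cos t) • N s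
      + (Q s * Real.sin t) • B s)
    (Cs Ct : ℝ → ℝ → EuclideanSpace ℝ (Fin 3))
    (hCs : ∀ s t, Cs s t = deriv (fun u => C u t) s)
    (hCt : ∀ s t, Ct s t = deriv (fun u => C s u) t)
    (E F G : ℝ → ℝ → ℝ)
    (hE : ∀ s t, E s t = ⟪Cs s t, Cs s t⟫)
    (hF : ∀ s t, F s t = ⟪Cs s t, Ct s t⟫)
    (hG : ∀ s t, G s t = ⟪Ct s t, Ct s t⟫)
    (n : ℝ → ℝ → EuclideanSpace ℝ (Fin 3))
    (hn : ∀ s t, n s t = (r s)⁻¹ • (C s t - α s))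
    (Css Cst Ctt : ℝ → ℝ → EuclideanSpace ℝ (Fin 3))
    (hCss : ∀ s t, Css s t = deriv (fun u => Cs u t) s)
    (hCst : ∀ s t, Cst s t = deriv (fun u => Cs s u) t)
    (hCtt : ∀ s t, Ctt s t = deriv (fun u => Ct s u) t)
    (e f g : ℝ → ℝ → ℝ)
    (he : ∀ s t, e s t = ⟪Css s t, n s t⟫)
    (hf : ∀ s t, f s t = ⟪Cst s t, n s t⟫)
    (hg : ∀ s t, g s t = ⟪Ctt s t, n s t⟫)
    (K : ℝ → ℝ → ℝ)
    (hK : ∀ s t, K s t = (e s t * g s t - f s t ^ 2) / (E s t * G s t - F s t ^ 2))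
    (H : ℝ → ℝ → ℝ)
    (hH : ∀ s t, H s t = (E s t * g s t - 2 * F s t * f s t + G s t * e s t)
      / (2 * (E s t * G s t - F s t ^ 2)))
    (a b d : ℝ) (habd : (a, b, d) ≠ (0, 0, 0))
    (hκne : ∀ s, κ s ≠ 0)
    (hreg : ∀ s t, E s t * G s t - F s t ^ 2 ≠ 0)
    (hlin : ∀ s t : ℝ, a * K s t + b * H s t = d)
    :
    d ≠ 0 ∧ b ^ 2 + 4 * a * d = 0 ∧ ∀ s : ℝ, r s = -b / (2 * d) := by
  have inner_frame (s : ℝ) := inner_orthonormal_frame (hT1 s) (hN1 s) (hB1 s)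
    (hTN s) (hTB s) (hNB s)
  have hasDeriv {V : Type} [NormedAddCommGroup V] [NormedSpace ℝ V] {u : ℝ → V}
      (hu : ContDiff ℝ (⊤ : ℕ∞) u) (s : ℝ) : HasDerivAt u (deriv u s) s :=
    (hu.differentiable (by simp) s).hasDerivAt
  have hw (s : ℝ) : 0 < 1 - deriv r s ^ 2 := by
    have := (sq_lt_one_iff_abs_lt_one (deriv r s)).mpr (hr1 s)
    linarith
  have hQpos (s : ℝ) : 0 < Q s := by
    rw [hQ]; exact mul_pos (hrpos s) (Real.sqrt_pos.mpr (hw s))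
  have hQsq (s : ℝ) : Q s ^ 2 = r s ^ 2 - R s ^ 2 := by
    rw [hQ, hR, mul_pow, Real.sq_sqrt (hw s).le]; ring
  have hr' : ContDiff ℝ (⊤ : ℕ∞) (deriv r) := (contDiff_infty_iff_deriv.mp hr).2
  have hRc : ContDiff ℝ (⊤ : ℕ∞) R := by
    rw [funext hR]; exact hr.mul hr'
  have hQc : ContDiff ℝ (⊤ : ℕ∞) Q := by
    rw [funext hQ]
    exact hr.mul ((contDiff_const.sub (hr'.pow 2)).sqrt fun s => (hw s).ne')
  have hQQ' (s : ℝ) : Q s * deriv Q s = R s * (1 - deriv R s) := by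
    have h1 := (hasDeriv hQc s).pow 2
    have h2 := ((hasDeriv hr s).pow 2).sub ((hasDeriv hRc s).pow 2)
    have h3 : (Q ^ 2 : ℝ → ℝ) = r ^ 2 - R ^ 2 := funext hQsq
    rw [h3] at h1
    have h4 := h1.unique h2
    norm_num at h4
    linarith [hR s]
  have hCc (t : ℝ) : ContDiff ℝ (⊤ : ℕ∞) (fun u => C u t) := by
    simp only [hC]
    fun_prop
  have hCs_coord (s t : ℝ) : Cs s t = (1 - deriv R s + Q s * κ s * Real.cos t) • T s
      + (-R s * κ s - deriv Q s * Real.cos t - Q s * τ s * Real.sin t) • N s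
      + (deriv Q s * Real.sin t - Q s * τ s * Real.cos t) • B s := by
    have h := (((hasDeriv hα s).sub ((hasDeriv hRc s).smul (hasDeriv hT s))).sub
      (((hasDeriv hQc s).mul_const (Real.cos t)).smul (hasDeriv hN s))).add
      (((hasDeriv hQc s).mul_const (Real.sin t)).smul (hasDeriv hB s))
    rw [← hTα, hT', hN', hB'] at h
    rw [hCs]
    simp only [hC]
    refine Eq.trans h.deriv ?_
    module
  have hCt_coord (s t : ℝ) : Ct s t =
      (0 : ℝ) • T s + (Q s * Real.sin t) • N s + (Q s * Real.cos t) • B s := by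
    have h := ((((Real.hasDerivAt_cos t).const_mul (Q s)).smul_const (N s)).const_sub
      (α s - R s • T s)).add (((Real.hasDerivAt_sin t).const_mul (Q s)).smul_const (B s))
    rw [hCt]
    simp only [hC]
    refine Eq.trans h.deriv ?_
    module
  have hCtt_coord (s t : ℝ) : Ctt s t =
      (0 : ℝ) • T s + (Q s * Real.cos t) • N s + (-(Q s * Real.sin t)) • B s := by
    have h := ((((Real.hasDerivAt_sin t).const_mul (Q s)).smul_const (N s)).const_add
      ((0 : ℝ) • T s)).add (((Real.hasDerivAt_cos t).const_mul (Q s)).smul_const (B s))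
    rw [hCtt]
    simp only [hCt_coord]
    refine Eq.trans h.deriv ?_
    module
  have hn_coord (s t : ℝ) : n s t = (-((r s)⁻¹ * R s)) • T s
      + (-((r s)⁻¹ * (Q s * Real.cos t))) • N s + ((r s)⁻¹ * (Q s * Real.sin t)) • B s := by
    rw [hn, hC]
    module
  have hperp (s t : ℝ) : ⟪Cs s t, n s t⟫ = 0 := by
    rw [hCs_coord, hn_coord, inner_frame]
    linear_combination (r s)⁻¹ * hQQ' s
      + (r s)⁻¹ * Q s * deriv Q s * Real.sin_sq_add_cos_sq t
  have hCsT (s t : ℝ) : ⟪Cs s t, T s⟫ = 1 - deriv R s + Q s * κ s * Real.cos t := by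
    have h : ⟪Cs s t, (1 : ℝ) • T s + (0 : ℝ) • N s + (0 : ℝ) • B s⟫
        = 1 - deriv R s + Q s * κ s * Real.cos t := by
      rw [hCs_coord, inner_frame]
      ring
    simpa only [one_smul, zero_smul, add_zero] using h
  have he_eq (s t : ℝ) : e s t = -(E s t - (1 - deriv R s + Q s * κ s * Real.cos t)) / r s := by
    have hCsd : DifferentiableAt ℝ (fun u => Cs u t) s := by
      simp only [hCs]
      exact (contDiff_infty_iff_deriv.mp (hCc t)).2.differentiable (by simp) s
    have hnd := ((hasDeriv hr s).inv (hrpos s).ne').smul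
      ((hasDeriv (hCc t) s).sub (hasDeriv hα s))
    have hzero : ⟪Cs s t, C s t - α s⟫ = 0 := by
      have := hperp s t
      rw [hn, real_inner_smul_right] at this
      exact (mul_eq_zero.mp this).resolve_left (inv_ne_zero (hrpos s).ne')
    rw [he, hCss, hn]
    refine (inner_deriv_eq_neg_of_inner_eq_zero hCsd hnd fun u => ?_).trans ?_
    · have := hperp u t
      rwa [hn] at this
    · rw [← hCs, ← hTα, inner_add_right, real_inner_smul_right, real_inner_smul_right,
        Pi.sub_apply, hzero, inner_sub_right, hCsT, ← hE, Pi.inv_apply]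
      ring
  have hf_eq (s t : ℝ) : f s t = -F s t / r s := by
    have hCsd : DifferentiableAt ℝ (fun u => Cs s u) t := by
      simp only [hCs_coord]
      fun_prop
    have hCd : DifferentiableAt ℝ (fun u => C s u) t := by
      simp only [hC]
      fun_prop
    have hnd := (hCd.hasDerivAt.sub_const (α s)).const_smul (r s)⁻¹
    rw [hf, hCst, hn]
    refine (inner_deriv_eq_neg_of_inner_eq_zero hCsd hnd fun u => ?_).trans ?_
    · have := hperp s u
      rwa [hn] at this
    · rw [← hCt, real_inner_smul_right, ← hF]
      ring
  have hG_eq (s t : ℝ) : G s t = Q s ^ 2 := by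
    rw [hG, hCt_coord, inner_frame]
    linear_combination Q s ^ 2 * Real.sin_sq_add_cos_sq t
  have hg_eq (s t : ℝ) : g s t = -G s t / r s := by
    rw [hG_eq, hg, hCtt_coord, hn_coord, inner_frame]
    linear_combination -(r s)⁻¹ * Q s ^ 2 * Real.sin_sq_add_cos_sq t
  have hdet (s t : ℝ) : E s t * G s t - F s t ^ 2
      = r s ^ 2 * (1 - deriv R s + Q s * κ s * Real.cos t) ^ 2 := by
    have hp := hperp s t
    rw [hCs_coord, hn_coord, inner_frame] at hp
    rw [hE, hF, hG_eq, hCs_coord, hCt_coord, inner_frame, inner_frame]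
    generalize 1 - deriv R s + Q s * κ s * Real.cos t = x at *
    generalize -R s * κ s - deriv Q s * Real.cos t - Q s * τ s * Real.sin t = y at *
    generalize deriv Q s * Real.sin t - Q s * τ s * Real.cos t = z at *
    have hp' : Q s * (y * Real.cos t - z * Real.sin t) = -(R s * x) := by
      have h0 := (hrpos s).ne'
      field_simp at hp
      linarith
    linear_combination x ^ 2 * hQsq s
      + (Q s * (y * Real.cos t - z * Real.sin t) - R s * x) * hp'
      - Q s ^ 2 * (y ^ 2 + z ^ 2) * Real.sin_sq_add_cos_sq t
  have key (s : ℝ) : a - b * r s - d * r s ^ 2 = 0 ∧ a - b * r s / 2 = 0 := by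
    have rel (t : ℝ) := by
      refine canal_weingarten_relation (a := a) (b := b) (d := d) (hrpos s).ne' (hG_eq s t)
        (hdet s t) (fun h0 => hreg s t ?_) ?_
      · rw [hdet, h0]; ring
      · rw [← hlin s t, hK, hH, he_eq, hf_eq, hg_eq]
    have hne : 1 - deriv R s + Q s * κ s * Real.cos 0
        ≠ 1 - deriv R s + Q s * κ s * Real.cos Real.pi := by
      rw [Real.cos_zero, Real.cos_pi]
      intro h
      have : Q s * κ s = 0 := by linarith
      exact mul_ne_zero (hQpos s).ne' (hκne s) this
    obtain ⟨h1, h2⟩ := eq_zero_of_mul_eq_of_ne hne (rel 0) (rel Real.pi)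
    exact ⟨(mul_eq_zero.mp h1).resolve_left (pow_ne_zero 2 (hrpos s).ne'),
      (mul_eq_zero.mp h2).resolve_left (pow_ne_zero 2 (hQpos s).ne')⟩
  have hbd (s : ℝ) : b = -(2 * d * r s) := by
    obtain ⟨h1, h2⟩ := key s
    refine mul_right_cancel₀ (hrpos s).ne' ?_
    linear_combination 2 * h2 - 2 * h1
  have hd : d ≠ 0 := by
    rintro rfl
    have hb : b = 0 := by simpa using hbd 0
    have ha : a = 0 := by simpa [hb] using (key 0).2
    exact habd (by rw [ha, hb])
  refine ⟨hd, ?_, fun s => ?_⟩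
  · linear_combination 4 * d * (key 0).2 + b * hbd 0
  · rw [hbd s]
    field_simp
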